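/- Let X be an Archimedean lattice-ordered algebra with multiplicative identity 1_X admitting a polynomial growth continuous function calculus, and for each n ∈ ℕ and x = (x₁, …, xₙ) ∈ Xⁿ let Ψ_x : PG_n → X denote the unique lattice-algebra homomorphism with Ψ_x(𝟙) = 1_X and Ψ_x(πᵢ) = xᵢ. Then for all m, n ∈ ℕ, x ∈ Xⁿ, f₁, …, f_m ∈ PG_n and g ∈ PG_m, one has Ψ_{(Ψ_x(f₁), …, Ψ_x(f_m))}(g) = Ψ_x(g ∘ (f₁ × ⋯ × f_m)), where (f₁ × ⋯ × f_m)(t) = (f₁(t), …, f_m(t)) for t ∈ ℝⁿ. -/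

import Mathlib

open scoped BigOperators

/-- A continuous function `ℝⁿ → ℝ` of polynomial growth (an element of `PG_n`). -/
def PolyGrowth (n : ℕ) (f : (Fin n → ℝ) → ℝ) : Prop :=
  Continuous f ∧ ∃ (M : ℝ) (N : ℕ), 0 ≤ M ∧
    ∀ t : Fin n → ℝ, |f t| ≤ M * (1 + ∑ i : Fin n, |t i|) ^ N

/-- An element of `PG_n^h`: a polynomial growth continuous function `f` such that
`f (t • x) / t` converges as `t → 0⁺`, uniformly in `x` on every bounded set. -/
def PolyGrowthH (n : ℕ) (f : (Fin n → ℝ) → ℝ) : Prop :=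
  PolyGrowth n f ∧ ∃ fh : (Fin n → ℝ) → ℝ,
    ∀ B : Set (Fin n → ℝ), Bornology.IsBounded B →
      ∀ ε : ℝ, 0 < ε → ∃ δ : ℝ, 0 < δ ∧
        ∀ t : ℝ, 0 < t → t < δ → ∀ y ∈ B, |f (t • y) / t - fh y| < ε

/-- An element of `H_n`: a continuous positively homogeneous function `ℝⁿ → ℝ`. -/
def PosHomog (n : ℕ) (f : (Fin n → ℝ) → ℝ) : Prop :=
  Continuous f ∧ ∀ (c : ℝ), 0 ≤ c → ∀ t : Fin n → ℝ, f (c • t) = c * f t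

section Defs

variable {X : Type*} [Lattice X] [AddCommGroup X] [Module ℝ X]

/-- The order ideal `I_e` generated by `e`. -/
def idealSet (e : X) : Set X := {x : X | ∃ c : ℝ, 0 ≤ c ∧ |x| ≤ c • e}

/-- The norm `‖x‖_e = inf {c ≥ 0 : |x| ≤ c • e}`. -/
noncomputable def regNorm (e x : X) : ℝ := sInf {c : ℝ | 0 ≤ c ∧ |x| ≤ c • e}

/-- The norm `‖·‖_e` is complete on the set `S`: every `‖·‖_e`-Cauchy sequence in `S`
converges, in `‖·‖_e`, to an element of `S`. -/
def NormComplete (e : X) (S : Set X) : Prop :=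
  ∀ u : ℕ → X, (∀ k, u k ∈ S) →
    (∀ ε : ℝ, 0 < ε → ∃ N : ℕ, ∀ p q : ℕ, N ≤ p → N ≤ q → regNorm e (u p - u q) < ε) →
    ∃ x ∈ S, ∀ ε : ℝ, 0 < ε → ∃ N : ℕ, ∀ p : ℕ, N ≤ p → regNorm e (u p - x) < ε

/-- A uniformly complete vector lattice: `(I_e, ‖·‖_e)` is complete for every `e ≥ 0`. -/
def UniformlyComplete (X : Type*) [Lattice X] [AddCommGroup X] [Module ℝ X] : Prop :=
  ∀ e : X, 0 ≤ e → NormComplete e (idealSet e)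

/-- A subset `Z` is uniformly complete as a vector lattice in its own right. -/
def UCSet (Z : Set X) : Prop :=
  ∀ e ∈ Z, 0 ≤ e → NormComplete e (Z ∩ idealSet e)

/-- A (vector) sublattice: a linear subspace closed under binary suprema. -/
def IsSublatticeSet (Z : Set X) : Prop :=
  (0 ∈ Z) ∧ (∀ a ∈ Z, ∀ b ∈ Z, a + b ∈ Z) ∧ (∀ (c : ℝ), ∀ a ∈ Z, c • a ∈ Z) ∧
  (∀ a ∈ Z, -a ∈ Z) ∧ (∀ a ∈ Z, ∀ b ∈ Z, a ⊔ b ∈ Z) ∧ (∀ a ∈ Z, ∀ b ∈ Z, a ⊓ b ∈ Z)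

/-- An order ideal: a linear subspace that is solid. -/
def IsOrderIdealSet (I : Set X) : Prop :=
  (0 ∈ I) ∧ (∀ a ∈ I, ∀ b ∈ I, a + b ∈ I) ∧ (∀ (c : ℝ), ∀ a ∈ I, c • a ∈ I) ∧
  (∀ a ∈ I, ∀ b : X, |b| ≤ |a| → b ∈ I)

/-- A vector lattice homomorphism defined on the class of functions `ℝⁿ → ℝ`
satisfying the predicate `P` (with pointwise operations), taking values in `X`. -/
def IsLatHom {n : ℕ} (P : ((Fin n → ℝ) → ℝ) → Prop) (Φ : ∀ f, P f → X) : Prop :=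
  (∀ (f g : (Fin n → ℝ) → ℝ) (hf : P f) (hg : P g) (hfg : P (f + g)),
      Φ (f + g) hfg = Φ f hf + Φ g hg) ∧
  (∀ (c : ℝ) (f : (Fin n → ℝ) → ℝ) (hf : P f) (hcf : P (c • f)),
      Φ (c • f) hcf = c • Φ f hf) ∧
  (∀ (f g : (Fin n → ℝ) → ℝ) (hf : P f) (hg : P g) (hfg : P (f ⊔ g)),
      Φ (f ⊔ g) hfg = Φ f hf ⊔ Φ g hg)

end Defs

section MulDefs

variable {X : Type*} [Lattice X] [AddCommGroup X] [Module ℝ X] [Mul X]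

/-- A lattice-algebra homomorphism defined on the class of functions `ℝⁿ → ℝ`
satisfying the predicate `P` (with pointwise operations), taking values in `X`. -/
def IsLatAlgHom {n : ℕ} (P : ((Fin n → ℝ) → ℝ) → Prop) (Ψ : ∀ f, P f → X) : Prop :=
  IsLatHom P Ψ ∧
  (∀ (f g : (Fin n → ℝ) → ℝ) (hf : P f) (hg : P g) (hfg : P (f * g)),
      Ψ (f * g) hfg = Ψ f hf * Ψ g hg)

/-- A sublattice-algebra: a linear subspace that is both a sublattice and a subalgebra. -/
def IsSublatticeAlgebraSet (Z : Set X) : Prop :=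
  IsSublatticeSet Z ∧ ∀ a ∈ Z, ∀ b ∈ Z, a * b ∈ Z

/-- The `f`-algebra condition, relativized to a subset. -/
def IsFAlgebraSet (Z : Set X) : Prop :=
  ∀ a ∈ Z, ∀ b ∈ Z, ∀ z ∈ Z, a ⊓ b = 0 → 0 ≤ z → (z * a) ⊓ b = 0 ∧ (a * z) ⊓ b = 0

/-- An `f`-subalgebra: a sublattice-algebra which is itself an `f`-algebra. -/
def IsFSubalgebra (Z : Set X) : Prop := IsSublatticeAlgebraSet Z ∧ IsFAlgebraSet Z

/-- `powS e m = e^(m+1)`, defined without assuming an identity element. -/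
def powS (e : X) : ℕ → X
  | 0 => e
  | m + 1 => powS e m * e

end MulDefs

/-- A map `T : X → A` which is a lattice-algebra homomorphism on a subset `S` of `X`. -/
def IsLatAlgHomOn {X A : Type*} [Lattice X] [AddCommGroup X] [Module ℝ X] [Mul X]
    [Lattice A] [AddCommGroup A] [Module ℝ A] [Mul A] (S : Set X) (T : X → A) : Prop :=
  (∀ a ∈ S, ∀ b ∈ S, T (a + b) = T a + T b) ∧
  (∀ (c : ℝ), ∀ a ∈ S, T (c • a) = c • T a) ∧
  (∀ a ∈ S, ∀ b ∈ S, T (a ⊔ b) = T a ⊔ T b) ∧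
  (∀ a ∈ S, ∀ b ∈ S, T (a * b) = T a * T b)

namespace PolyGrowth

variable {n : ℕ} {f g : (Fin n → ℝ) → ℝ}

theorem one_le_weight (t : Fin n → ℝ) : 1 ≤ 1 + ∑ i, |t i| :=
  le_add_of_nonneg_right (Finset.sum_nonneg fun _ _ => abs_nonneg _)

theorem norm_le_weight (t : Fin n → ℝ) : ‖t‖ ≤ 1 + ∑ i, |t i| := by
  refine (pi_norm_le_iff_of_nonneg (zero_le_one.trans (one_le_weight t))).2 fun i => ?_
  have := Finset.single_le_sum (f := fun i => |t i|) (fun _ _ => abs_nonneg _) (Finset.mem_univ i)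
  rw [Real.norm_eq_abs]
  linarith

theorem of_abs_le (hf : Continuous f) {M : ℝ} {N : ℕ}
    (h : ∀ t, |f t| ≤ M * (1 + ∑ i, |t i|) ^ N) : PolyGrowth n f := by
  refine ⟨hf, |M|, N, abs_nonneg M, fun t => (h t).trans ?_⟩
  have := one_le_weight t
  gcongr
  exact le_abs_self M

theorem const (c : ℝ) : PolyGrowth n fun _ => c :=
  of_abs_le (M := |c|) (N := 0) continuous_const fun t => by simp

theorem proj (i : Fin n) : PolyGrowth n fun t => t i :=
  of_abs_le (M := 1) (N := 1) (continuous_apply i) fun t => by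
    have := Finset.single_le_sum (f := fun i => |t i|) (fun _ _ => abs_nonneg _)
      (Finset.mem_univ i)
    simp only [pow_one, one_mul]
    linarith

theorem mono (hg : PolyGrowth n g) (hf : Continuous f) (h : ∀ t, |f t| ≤ |g t|) :
    PolyGrowth n f := by
  obtain ⟨-, M, N, -, hM⟩ := hg
  exact of_abs_le hf fun t => (h t).trans (hM t)

theorem mul (hf : PolyGrowth n f) (hg : PolyGrowth n g) : PolyGrowth n (f * g) := by
  obtain ⟨hf, M, N, hM, h⟩ := hf
  obtain ⟨hg, M', N', hM', h'⟩ := hg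
  refine of_abs_le (M := M * M') (N := N + N') (hf.mul hg) fun t => ?_
  have := one_le_weight t
  calc |f t * g t| = |f t| * |g t| := abs_mul _ _
    _ ≤ (M * (1 + ∑ i, |t i|) ^ N) * (M' * (1 + ∑ i, |t i|) ^ N') := by
      gcongr
      exacts [h t, h' t]
    _ = _ := by ring

theorem abs_add_abs (hf : PolyGrowth n f) (hg : PolyGrowth n g) :
    PolyGrowth n fun t => |f t| + |g t| := by
  obtain ⟨hf, M, N, hM, h⟩ := hf
  obtain ⟨hg, M', N', hM', h'⟩ := hg
  refine of_abs_le (M := M + M') (N := N + N') (hf.abs.add hg.abs) fun t => ?_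
  have := one_le_weight t
  rw [abs_of_nonneg (by positivity)]
  calc |f t| + |g t| ≤ M * (1 + ∑ i, |t i|) ^ N + M' * (1 + ∑ i, |t i|) ^ N' :=
      add_le_add (h t) (h' t)
    _ ≤ M * (1 + ∑ i, |t i|) ^ (N + N') + M' * (1 + ∑ i, |t i|) ^ (N + N') := by
      gcongr <;> first | assumption | omega
    _ = _ := by ring

theorem add (hf : PolyGrowth n f) (hg : PolyGrowth n g) : PolyGrowth n (f + g) :=
  (hf.abs_add_abs hg).mono (hf.1.add hg.1) fun _ =>
    (abs_add_le _ _).trans (le_abs_self _)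

theorem sup (hf : PolyGrowth n f) (hg : PolyGrowth n g) : PolyGrowth n (f ⊔ g) :=
  (hf.abs_add_abs hg).mono (hf.1.sup hg.1) fun t => by
    refine le_trans ?_ (le_abs_self _)
    have := abs_max_le_max_abs_abs (a := f t) (b := g t)
    exact this.trans (max_le_add_of_nonneg (abs_nonneg _) (abs_nonneg _))

theorem smul (c : ℝ) (hf : PolyGrowth n f) : PolyGrowth n (c • f) :=
  (const c).mul hf

theorem sum_abs {ι : Type*} (s : Finset ι) {F : ι → (Fin n → ℝ) → ℝ}
    (hF : ∀ j, PolyGrowth n (F j)) : PolyGrowth n fun t => ∑ j ∈ s, |F j t| := by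
  classical
  induction s using Finset.induction_on with
  | empty => simpa using const 0
  | insert a s ha ih =>
    refine ((hF a).abs_add_abs ih).mono ?_ fun t => ?_
    · exact continuous_finsetSum _ fun j _ => (hF j).1.abs
    · rw [Finset.sum_insert ha, abs_of_nonneg (Finset.sum_nonneg fun _ _ => abs_nonneg _ :
        0 ≤ ∑ j ∈ s, |F j t|)]

theorem pow (hf : PolyGrowth n f) (N : ℕ) : PolyGrowth n (f ^ N) := by
  induction N with
  | zero => exact const 1
  | succ N ih => simpa [pow_succ] using ih.mul hf

theorem comp {m : ℕ} {g : (Fin m → ℝ) → ℝ} (hg : PolyGrowth m g)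
    {F : Fin m → (Fin n → ℝ) → ℝ} (hF : ∀ j, PolyGrowth n (F j)) :
    PolyGrowth n fun t => g fun j => F j t := by
  obtain ⟨hg, M, N, hM, h⟩ := hg
  have hw : PolyGrowth n fun t => 1 + ∑ j, |F j t| := (const 1).add (sum_abs _ hF)
  exact (smul M (hw.pow N)).mono (hg.comp (continuous_pi fun j => (hF j).1))
    fun t => (h _).trans (le_abs_self _)

end PolyGrowth

namespace IsLatAlgHom

variable {X : Type*} [Lattice X] [Ring X] [Module ℝ X] {n : ℕ}
  {A B : ∀ f : (Fin n → ℝ) → ℝ, PolyGrowth n f → X}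

theorem mono (hA : IsLatAlgHom (PolyGrowth n) A) {f g : (Fin n → ℝ) → ℝ}
    (hf : PolyGrowth n f) (hg : PolyGrowth n g) (h : f ≤ g) : A f hf ≤ A g hg := by
  have key := hA.1.2.2 f g hf hg (hf.sup hg)
  simp only [sup_eq_right.2 h] at key
  exact key ▸ le_sup_left

/-- The functions on which two unital lattice-algebra homomorphisms agree. -/
def equalizer (hA : IsLatAlgHom (PolyGrowth n) A) (hB : IsLatAlgHom (PolyGrowth n) B)
    (hone : ∀ h, A 1 h = B 1 h) : Subalgebra ℝ C(Fin n → ℝ, ℝ) where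
  carrier := {h | ∃ hh : PolyGrowth n h, A h hh = B h hh}
  mul_mem' := by
    rintro f g ⟨hf, hf'⟩ ⟨hg, hg'⟩
    refine ⟨hf.mul hg, ?_⟩
    exact (hA.2 f g hf hg _).trans ((congrArg₂ _ hf' hg').trans (hB.2 f g hf hg _).symm)
  add_mem' := by
    rintro f g ⟨hf, hf'⟩ ⟨hg, hg'⟩
    refine ⟨hf.add hg, ?_⟩
    exact (hA.1.1 f g hf hg _).trans ((congrArg₂ _ hf' hg').trans (hB.1.1 f g hf hg _).symm)
  algebraMap_mem' c := by
    have h1 : PolyGrowth n 1 := PolyGrowth.const 1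
    have hc : ⇑(algebraMap ℝ C(Fin n → ℝ, ℝ) c) = c • (1 : (Fin n → ℝ) → ℝ) := by
      ext t
      simp
    refine ⟨hc ▸ h1.smul c, ?_⟩
    simp only [hc]
    rw [hA.1.2.1 c 1 h1, hB.1.2.1 c 1 h1, hone]

variable {hA : IsLatAlgHom (PolyGrowth n) A} {hB : IsLatAlgHom (PolyGrowth n) B}
  {hone : ∀ h, A 1 h = B 1 h}

theorem sup_mem_equalizer {f g : C(Fin n → ℝ, ℝ)} (hf : f ∈ equalizer hA hB hone)
    (hg : g ∈ equalizer hA hB hone) : f ⊔ g ∈ equalizer hA hB hone := by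
  obtain ⟨hf, hf'⟩ := hf
  obtain ⟨hg, hg'⟩ := hg
  refine ⟨hf.sup hg, ?_⟩
  exact (hA.1.2.2 f g hf hg _).trans ((congrArg₂ _ hf' hg').trans (hB.1.2.2 f g hf hg _).symm)

theorem inf_mem_equalizer {f g : C(Fin n → ℝ, ℝ)} (hf : f ∈ equalizer hA hB hone)
    (hg : g ∈ equalizer hA hB hone) : f ⊓ g ∈ equalizer hA hB hone := by
  have h := neg_mem (sup_mem_equalizer (neg_mem hf) (neg_mem hg))
  rwa [← neg_inf, neg_neg] at h

end IsLatAlgHom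

/-- A subalgebra of `C(ℝⁿ, ℝ)` which contains the projections and is closed under suprema and
infima approximates every function of polynomial growth, uniformly relative to some weight. -/
theorem PolyGrowth.exists_mem_subalgebra_abs_sub_le {n : ℕ} (S : Subalgebra ℝ C(Fin n → ℝ, ℝ))
    (hproj : ∀ i, (⟨fun t => t i, continuous_apply i⟩ : C(Fin n → ℝ, ℝ)) ∈ S)
    (hsup : ∀ f ∈ S, ∀ g ∈ S, f ⊔ g ∈ S) (hinf : ∀ f ∈ S, ∀ g ∈ S, f ⊓ g ∈ S)
    {g : (Fin n → ℝ) → ℝ} (hg : PolyGrowth n g) :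
    ∃ w ∈ S, (∀ t, 0 ≤ w t) ∧
      ∀ ε : ℝ, 0 < ε → ∃ h ∈ S, ∀ t, |h t - g t| ≤ ε * w t := by
  obtain ⟨hgc, M, N, hM, hgM⟩ := hg
  let p : Fin n → C(Fin n → ℝ, ℝ) := fun i => ⟨fun t => t i, continuous_apply i⟩
  let W : C(Fin n → ℝ, ℝ) := 1 + ∑ i, (p i ⊔ -p i)
  have hW : ∀ t, W t = 1 + ∑ i, |t i| := fun t => by
    simp [W, p, abs]
  have hWS : W ∈ S :=
    add_mem (one_mem S) (sum_mem fun i _ => hsup _ (hproj i) _ (neg_mem (hproj i)))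
  have hW1 : ∀ t, 1 ≤ W t := fun t => hW t ▸ PolyGrowth.one_le_weight t
  have hW0 : ∀ t, 0 ≤ W t := fun t => zero_le_one.trans (hW1 t)
  refine ⟨W ^ (N + 1), pow_mem hWS _, fun t => by simpa using pow_nonneg (hW0 t) _,
    fun ε hε => ?_⟩
  have hsep : S.SeparatesPoints := by
    intro a b hab
    obtain ⟨i, hi⟩ := Function.ne_iff.1 hab
    exact ⟨_, ⟨_, hproj i, rfl⟩, hi⟩
  obtain ⟨q, hq, hqg⟩ :=
    ContinuousMap.exists_mem_subalgebra_near_continuous_of_isCompact_of_separatesPoints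
      hsep ⟨g, hgc⟩ (isCompact_closedBall 0 (2 * M / ε)) hε
  let u : C(Fin n → ℝ, ℝ) := M • W ^ N
  have hu : u ∈ S := S.smul_mem (pow_mem hWS _) M
  have hgu : ∀ t, |g t| ≤ u t := fun t => by simpa [u, hW] using hgM t
  refine ⟨(q ⊓ u) ⊔ -u, hsup _ (hinf _ hq _ hu) _ (neg_mem hu), fun t => ?_⟩
  have hgt := abs_le.1 (hgu t)
  simp only [ContinuousMap.sup_apply, ContinuousMap.inf_apply, ContinuousMap.neg_apply,
    ContinuousMap.pow_apply]
  by_cases ht : t ∈ Metric.closedBall (0 : Fin n → ℝ) (2 * M / ε)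
  · have hclose : |q t - g t| ≤ ε := (hqg t ht).le
    have hε1 : ε ≤ ε * W t ^ (N + 1) := le_mul_of_one_le_right hε.le (one_le_pow₀ (hW1 t))
    refine le_trans ?_ hε1
    rw [abs_le] at hclose ⊢
    grind
  · have hlt : 2 * M / ε < W t := by
      rw [hW]
      rw [mem_closedBall_zero_iff, not_le] at ht
      exact ht.trans_le (PolyGrowth.norm_le_weight t)
    have hfar : 2 * u t ≤ ε * W t ^ (N + 1) := by
      have h1 : 2 * M ≤ W t * ε := ((div_lt_iff₀ hε).1 hlt).le
      calc 2 * u t = 2 * M * W t ^ N := by simp [u, mul_assoc]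
        _ ≤ W t * ε * W t ^ N := mul_le_mul_of_nonneg_right h1 (pow_nonneg (hW0 t) N)
        _ = ε * W t ^ (N + 1) := by ring
    refine le_trans ?_ hfar
    rw [abs_le]
    grind

/-- In an Archimedean vector lattice, a difference below all positive multiples of a positive
element is nonpositive. -/
theorem le_of_forall_le_add_smul {X : Type*} [Lattice X] [AddCommGroup X] [Module ℝ X]
    [IsOrderedAddMonoid X] (hsmulpos : ∀ (c : ℝ) (y : X), 0 ≤ c → 0 ≤ y → 0 ≤ c • y)
    (harch : ∀ y z : X, 0 ≤ y → 0 ≤ z → (∀ k : ℕ, k • y ≤ z) → y = 0)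
    {a b c : X} (hc : 0 ≤ c) (h : ∀ ε : ℝ, 0 < ε → a ≤ b + ε • c) : a ≤ b := by
  have key : (a - b) ⊔ 0 = 0 := by
    refine harch _ c le_sup_right hc fun k => ?_
    rcases k.eq_zero_or_pos with rfl | hk
    · simpa using hc
    have hk' : (0 : ℝ) < k := Nat.cast_pos.2 hk
    have hle : (a - b) ⊔ 0 ≤ (k : ℝ)⁻¹ • c :=
      sup_le (sub_le_iff_le_add'.2 (h _ (inv_pos.2 hk'))) (hsmulpos _ _ (inv_pos.2 hk').le hc)
    calc k • ((a - b) ⊔ 0) ≤ k • ((k : ℝ)⁻¹ • c) := nsmul_le_nsmul_right hle k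
      _ = c := by rw [← Nat.cast_smul_eq_nsmul ℝ, smul_inv_smul₀ hk'.ne']
  exact sub_nonpos.1 (sup_eq_right.1 key)

/-- A unital lattice-algebra homomorphism from the functions of polynomial growth to an
Archimedean lattice-ordered algebra is determined by its values at the projections. -/
theorem IsLatAlgHom.eq_of_proj {X : Type*} [Lattice X] [Ring X] [Module ℝ X]
    [IsOrderedAddMonoid X] (hsmulpos : ∀ (c : ℝ) (y : X), 0 ≤ c → 0 ≤ y → 0 ≤ c • y)
    (harch : ∀ y z : X, 0 ≤ y → 0 ≤ z → (∀ k : ℕ, k • y ≤ z) → y = 0) {n : ℕ}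
    {A B : ∀ f : (Fin n → ℝ) → ℝ, PolyGrowth n f → X}
    (hA : IsLatAlgHom (PolyGrowth n) A) (hB : IsLatAlgHom (PolyGrowth n) B)
    (hone : ∀ h, A 1 h = B 1 h) (hproj : ∀ i h, A (fun t => t i) h = B (fun t => t i) h)
    {g : (Fin n → ℝ) → ℝ} (hg : PolyGrowth n g) : A g hg = B g hg := by
  obtain ⟨w, ⟨hwP, hwE⟩, hw0, hw⟩ := hg.exists_mem_subalgebra_abs_sub_le (equalizer hA hB hone)
    (fun i => ⟨PolyGrowth.proj i, hproj i _⟩) (fun _ hf _ hg => sup_mem_equalizer hf hg)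
    (fun _ hf _ hg => inf_mem_equalizer hf hg)
  have h0 : 0 ≤ B w hwP := by
    have hz : B 0 (PolyGrowth.const 0) = 0 := by
      have := hB.1.2.1 0 w hwP (by rw [zero_smul]; exact PolyGrowth.const 0)
      simpa only [zero_smul] using this
    exact hz ▸ hB.mono (PolyGrowth.const 0) hwP hw0
  have key : ∀ ε : ℝ, 0 < ε →
      A g hg ≤ B g hg + ε • B w hwP ∧ B g hg ≤ A g hg + ε • B w hwP := by
    intro ε hε
    obtain ⟨h, ⟨hhP, hhE⟩, hh⟩ := hw (ε / 2) (half_pos hε)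
    have hs : PolyGrowth n ((ε / 2) • ⇑w) := hwP.smul _
    have h1 : g ≤ ⇑h + (ε / 2) • ⇑w := fun t => by
      have := (abs_le.1 (hh t)).1
      simp only [Pi.add_apply, Pi.smul_apply, smul_eq_mul]
      linarith
    have h2 : ⇑h ≤ g + (ε / 2) • ⇑w := fun t => by
      have := (abs_le.1 (hh t)).2
      simp only [Pi.add_apply, Pi.smul_apply, smul_eq_mul]
      linarith
    have hA1 := hA.mono hg (hhP.add hs) h1
    have hA2 := hA.mono hhP (hg.add hs) h2
    have hB1 := hB.mono hg (hhP.add hs) h1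
    have hB2 := hB.mono hhP (hg.add hs) h2
    rw [hA.1.1 _ _ hhP hs, hA.1.2.1 _ _ hwP, hhE, hwE] at hA1
    rw [hA.1.1 _ _ hg hs, hA.1.2.1 _ _ hwP, hhE, hwE] at hA2
    rw [hB.1.1 _ _ hhP hs, hB.1.2.1 _ _ hwP] at hB1
    rw [hB.1.1 _ _ hg hs, hB.1.2.1 _ _ hwP] at hB2
    have hε2 : ε • B w hwP = (ε / 2) • B w hwP + (ε / 2) • B w hwP := by
      rw [← add_smul, add_halves]
    rw [hε2, ← add_assoc, ← add_assoc]
    exact ⟨hA1.trans (add_le_add_left hB2 _), hB1.trans (add_le_add_left hA2 _)⟩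
  exact le_antisymm
    (le_of_forall_le_add_smul hsmulpos harch h0 fun ε hε => (key ε hε).1)
    (le_of_forall_le_add_smul hsmulpos harch h0 fun ε hε => (key ε hε).2)

/-- Corollary 3.2 / `cor:conditions`, composition identity. -/
theorem stmt_13 {X : Type*} [Lattice X] [Ring X] [Module ℝ X]
    [CovariantClass X X (· + ·) (· ≤ ·)] [IsScalarTower ℝ X X] [SMulCommClass ℝ X X]
    (hsmulpos : ∀ (c : ℝ) (y : X), 0 ≤ c → 0 ≤ y → 0 ≤ c • y)
    (hmulpos : ∀ y z : X, 0 ≤ y → 0 ≤ z → 0 ≤ y * z)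
    (harch : ∀ y z : X, 0 ≤ y → 0 ≤ z → (∀ k : ℕ, k • y ≤ z) → y = 0)
    (Ψ : ∀ (n : ℕ) (x : Fin n → X) (f : (Fin n → ℝ) → ℝ), PolyGrowth n f → X)
    (hhom : ∀ (n : ℕ) (x : Fin n → X), IsLatAlgHom (PolyGrowth n) (Ψ n x))
    (hone : ∀ (n : ℕ) (x : Fin n → X) (h1 : PolyGrowth n 1), Ψ n x 1 h1 = 1)
    (hproj : ∀ (n : ℕ) (x : Fin n → X) (i : Fin n) (hi : PolyGrowth n fun t => t i),
      Ψ n x (fun t => t i) hi = x i) :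
    ∀ (m n : ℕ) (x : Fin n → X) (f : Fin m → ((Fin n → ℝ) → ℝ))
      (hf : ∀ j, PolyGrowth n (f j)) (g : (Fin m → ℝ) → ℝ) (hg : PolyGrowth m g)
      (hgf : PolyGrowth n fun t => g fun j => f j t),
      Ψ m (fun j => Ψ n x (f j) (hf j)) g hg
        = Ψ n x (fun t => g fun j => f j t) hgf := by
  intro m n x f hf g hg hgf
  have : IsOrderedAddMonoid X :=
    { add_le_add_left := fun a b h c => by
        rw [add_comm a, add_comm b]
        exact CovariantClass.elim c h }
  have hcomp : IsLatAlgHom (PolyGrowth m)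
      (fun g hg => Ψ n x (fun t => g fun j => f j t) (hg.comp hf)) :=
    ⟨⟨fun a b ha hb _ => (hhom n x).1.1 _ _ (ha.comp hf) (hb.comp hf) _,
      fun c a ha _ => (hhom n x).1.2.1 c _ (ha.comp hf) _,
      fun a b ha hb _ => (hhom n x).1.2.2 _ _ (ha.comp hf) (hb.comp hf) _⟩,
      fun a b ha hb _ => (hhom n x).2 _ _ (ha.comp hf) (hb.comp hf) _⟩
  exact IsLatAlgHom.eq_of_proj hsmulpos harch (hhom m fun j => Ψ n x (f j) (hf j)) hcomp
    (fun h => (hone m _ h).trans (hone n x (h.comp hf)).symm) (fun i h => hproj m _ i h) hg
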